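/- Let V = (v₁,…,v_m) be a list of nonzero points in ℂ^d (possibly with repetitions) forming a δ-LCC configuration. Then the affine dimension of V is at most O(1/δ⁹). -/

import Mathlib

section Helpers

open Module

section Greedy
variable {K E : Type*} [Field K] [AddCommGroup E] [Module K E]

theorem finrank_span_image_finset_eq_card {ι : Type*} {v : ι → E} {C : Finset ι}
    (hC : LinearIndepOn K v (C : Set ι)) :
    finrank K (Submodule.span K (v '' (C : Set ι))) = C.card := by
  have := finrank_span_eq_card hC
  rw [Set.range_comp' v, Subtype.range_coe_subtype] at this
  simpa using this

/-- Greedy basis extraction along a sequence. -/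
theorem exists_greedy_linearIndepOn (v : ℕ → E) (s : ℕ → ℝ) (k : ℕ) :
    ∃ B : Finset ℕ, B ⊆ Finset.range k ∧ LinearIndepOn K v (B : Set ℕ) ∧
      Submodule.span K (v '' (B : Set ℕ)) = Submodule.span K (v '' (Finset.range k : Set ℕ)) ∧
      ∑ i ∈ B, s i = ∑ j ∈ Finset.range k,
        ((finrank K (Submodule.span K (v '' (Finset.range (j + 1) : Set ℕ))) : ℝ) -
          finrank K (Submodule.span K (v '' (Finset.range j : Set ℕ)))) * s j := by
  induction k with
  | zero => exact ⟨∅, by simp, by simp, by simp, by simp⟩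
  | succ k ih =>
    obtain ⟨B, hBk, hB, hspan, hsum⟩ := ih
    have himg : v '' (Finset.range (k + 1) : Set ℕ) =
        insert (v k) (v '' (Finset.range k : Set ℕ)) := by
      rw [Finset.range_add_one, Finset.coe_insert, Set.image_insert_eq]
    by_cases hk : v k ∈ Submodule.span K (v '' (B : Set ℕ))
    · have heq : Submodule.span K (v '' (Finset.range (k + 1) : Set ℕ)) =
          Submodule.span K (v '' (Finset.range k : Set ℕ)) := by
        rw [himg, Submodule.span_insert_eq_span (hspan ▸ hk)]
      refine ⟨B, hBk.trans (Finset.range_subset_range.2 k.le_succ), hB, by rw [heq, hspan], ?_⟩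
      rw [Finset.sum_range_succ, hsum, heq, sub_self, zero_mul, add_zero]
    · have hkB : k ∉ B := fun h => by simpa using hBk h
      have hins : LinearIndepOn K v ((insert k B : Finset ℕ) : Set ℕ) := by
        rw [Finset.coe_insert]; exact hB.insert hk
      have hspan' : Submodule.span K (v '' ((insert k B : Finset ℕ) : Set ℕ)) =
          Submodule.span K (v '' (Finset.range (k + 1) : Set ℕ)) := by
        rw [himg, Finset.coe_insert, Set.image_insert_eq, Submodule.span_insert,
          Submodule.span_insert, hspan]
      refine ⟨insert k B, ?_, hins, hspan', ?_⟩
      · rw [Finset.range_add_one]; exact Finset.insert_subset_insert _ hBk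
      · rw [Finset.sum_insert hkB, Finset.sum_range_succ, hsum, ← hspan', ← hspan,
          finrank_span_image_finset_eq_card hins, finrank_span_image_finset_eq_card hB, Finset.card_insert_of_notMem hkB]
        push_cast; ring

end Greedy

/-- Abel summation lower bound. -/
theorem abel_lower_bound (d s : ℕ → ℝ) (ε : ℝ) (m : ℕ) (hd0 : d 0 = 0)
    (hd : ∀ j, 1 ≤ j → j < m → ε ≤ d j) (hs : Antitone s) :
    ∀ k, k < m → d (k + 1) * s k + ε * (s 0 - s k) ≤
      ∑ j ∈ Finset.range (k + 1), (d (j + 1) - d j) * s j := by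
  intro k
  induction k with
  | zero => intro _; simp [hd0]
  | succ k ih =>
    intro hk
    rw [Finset.sum_range_succ]
    have h1 := ih (by omega)
    have h2 := mul_le_mul_of_nonneg_right (hd (k + 1) (by omega) hk)
      (sub_nonneg.2 (hs k.le_succ))
    simp only [Nat.succ_eq_add_one] at h2
    linarith

section Gap
variable {K E : Type*} [Field K] [AddCommGroup E] [Module K E]

open Classical in
theorem exists_basis_weight_gap {m : ℕ} (hE : 0 < finrank K E) (v : Fin m → E)
    (hv : ∀ i, v i ≠ 0) (hspan : Submodule.span K (Set.range v) = ⊤)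
    (hden : ∀ U : Submodule K E, U ≠ ⊥ → U ≠ ⊤ →
      finrank K E * (Finset.univ.filter fun i => v i ∈ U).card < m * finrank K U)
    (s : Fin m → ℝ) :
    ∃ B : Finset (Fin m), LinearIndepOn K v (B : Set (Fin m)) ∧ B.card = finrank K E ∧
      ∀ i j, (finrank K E / m : ℝ) * ∑ i, s i + 1 / m * (s i - s j) ≤ ∑ i ∈ B, s i := by
  rcases m with _ | m
  · exfalso
    rw [Set.range_eq_empty, Submodule.span_empty] at hspan
    have := finrank_top K E
    rw [← hspan, finrank_bot] at this
    omega
  set σ : Equiv.Perm (Fin (m + 1)) := Tuple.sort (fun i => -s i)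
  have hσ : Monotone ((fun i => -s i) ∘ σ) := Tuple.monotone_sort _
  set τ : ℕ → Fin (m + 1) := fun k => σ ⟨min k m, by omega⟩ with hτ
  have hτval : ∀ i : Fin (m + 1), τ i = σ i := fun i => by
    simp only [hτ]; congr 1; ext; simp; omega
  have hanti : Antitone (s ∘ τ) := fun a b hab => by
    have := @hσ ⟨min a m, by omega⟩ ⟨min b m, by omega⟩ (by simp [Fin.le_def]; omega)
    simpa using this
  have hinj : Set.InjOn τ (Finset.range (m + 1) : Set ℕ) := fun a ha b hb h => by
    simp only [Finset.coe_range, Set.mem_Iio] at ha hb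
    have := congrArg Fin.val (σ.injective h)
    simp at this; omega
  obtain ⟨B, hBm, hB, hBspan, hBsum⟩ :=
    exists_greedy_linearIndepOn (K := K) (v ∘ τ) (s ∘ τ) (m + 1)
  have hsumall : ∀ f : Fin (m + 1) → ℝ, ∑ j ∈ Finset.range (m + 1), f (τ j) = ∑ i, f i := by
    intro f
    rw [Finset.sum_range, ← Equiv.sum_comp σ f]
    exact Finset.sum_congr rfl fun i _ => by rw [hτval]
  have hfull : Submodule.span K ((v ∘ τ) '' (Finset.range (m + 1) : Set ℕ)) = ⊤ := by
    rw [← hspan]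
    congr 1
    ext x
    constructor
    · rintro ⟨k, -, rfl⟩; exact ⟨_, rfl⟩
    · rintro ⟨i, rfl⟩
      exact ⟨(σ.symm i : Fin (m + 1)), by simp [Nat.lt_succ_iff.1 (σ.symm i).2], by simp [hτval]⟩
  set r : ℕ → ℕ := fun j => finrank K (Submodule.span K ((v ∘ τ) '' (Finset.range j : Set ℕ)))
    with hr
  set c : ℝ := (finrank K E : ℝ) / (m + 1 : ℕ) with hc
  have hm0 : (0 : ℝ) < (m + 1 : ℕ) := by positivity
  have hcard : B.card = finrank K E := by
    rw [← finrank_span_image_finset_eq_card hB, hBspan, hfull, finrank_top]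
  have hd : ∀ j, 1 ≤ j → j < m + 1 → (1 : ℝ) / (m + 1 : ℕ) ≤ r j - c * j := by
    intro j hj hjm
    have key : finrank K E * j + 1 ≤ (m + 1) * r j := by
      by_cases htop : Submodule.span K ((v ∘ τ) '' (Finset.range j : Set ℕ)) = ⊤
      · have : r j = finrank K E := by simp only [hr]; rw [htop, finrank_top]
        rw [this]; nlinarith
      · have hbot : Submodule.span K ((v ∘ τ) '' (Finset.range j : Set ℕ)) ≠ ⊥ := fun h => by
          rw [Submodule.span_eq_bot] at h
          exact hv _ (h _ ⟨0, by simp; omega, rfl⟩)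
        have h1 := hden _ hbot htop
        have h2 : j ≤ (Finset.univ.filter fun i =>
            v i ∈ Submodule.span K ((v ∘ τ) '' (Finset.range j : Set ℕ))).card := by
          have : ((Finset.range j).image τ).card = j := by
            rw [Finset.card_image_of_injOn (hinj.mono _), Finset.card_range]
            intro x; simp; omega
          refine this.symm.le.trans ?_
          refine Finset.card_le_card fun i hi => ?_
          obtain ⟨k, hk, rfl⟩ := Finset.mem_image.1 hi
          simp only [Finset.mem_filter, Finset.mem_univ, true_and]
          exact Submodule.subset_span ⟨k, by simpa using hk, rfl⟩
        have h3 := Nat.mul_le_mul_left (finrank K E) h2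
        simp only [hr]
        omega
    have key' : (finrank K E : ℝ) * j + 1 ≤ (m + 1 : ℕ) * r j := by exact_mod_cast key
    rw [div_le_iff₀ hm0, hc]
    field_simp
    linarith
  have hr0 : r 0 = 0 := by
    simp only [hr]
    rw [Finset.range_zero, Finset.coe_empty, Set.image_empty, Submodule.span_empty, finrank_bot]
  have habel := abel_lower_bound (fun j => r j - c * j) (s ∘ τ) (1 / (m + 1 : ℕ)) (m + 1)
    (by simp [hr0]) hd hanti m (by omega)
  have hrm : (r (m + 1) : ℝ) = finrank K E := by simp only [hr]; rw [hfull, finrank_top]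
  have hend : (r (m + 1) : ℝ) - c * ((m + 1 : ℕ) : ℝ) = 0 := by
    rw [hrm, hc]; field_simp; ring
  have hsplit : ∑ j ∈ Finset.range (m + 1),
      (((r (j + 1) : ℝ) - c * ((j + 1 : ℕ) : ℝ)) - (r j - c * j)) * (s ∘ τ) j =
      ∑ i ∈ B, (s ∘ τ) i - c * ∑ i, s i := by
    rw [hBsum, ← hsumall s, Finset.mul_sum, ← Finset.sum_sub_distrib]
    refine Finset.sum_congr rfl fun j _ => ?_
    simp only [hr, Function.comp]
    push_cast; ring
  have hBinj : Set.InjOn τ (B : Set ℕ) := hinj.mono (Finset.coe_subset.2 hBm)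
  refine ⟨B.image τ, ?_, ?_, ?_⟩
  · rw [Finset.coe_image]
    exact hB.image_of_comp
  · rw [Finset.card_image_of_injOn hBinj, hcard]
  · intro i j
    rw [Finset.sum_image hBinj]
    beta_reduce at habel
    rw [hsplit, hend, zero_mul, zero_add] at habel
    have hle : ∀ i, s i ≤ (s ∘ τ) 0 := fun i => by
      have := hanti (Nat.zero_le (σ.symm i : Fin (m + 1)))
      simpa [hτval] using this
    have hge : ∀ i, (s ∘ τ) m ≤ s i := fun i => by
      have := hanti (Nat.lt_succ_iff.1 (σ.symm i : Fin (m + 1)).2)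
      simpa [hτval] using this
    have h3 : 1 / ((m + 1 : ℕ) : ℝ) * (s i - s j) ≤
        1 / ((m + 1 : ℕ) : ℝ) * ((s ∘ τ) 0 - (s ∘ τ) m) :=
      mul_le_mul_of_nonneg_left (by linarith [hle i, hge j]) (by positivity)
    simp only [Function.comp] at habel h3 ⊢
    linarith

end Gap

section Scatter
open Matrix
open scoped ComplexOrder MatrixOrder
variable {ι κ : Type*}

/-- The weighted scatter matrix `∑ i ∈ D, t i • v i (v i)ᴴ`. -/
noncomputable def scatter (v : ι → κ → ℂ) (D : Finset ι) (t : ι → ℝ) : Matrix κ κ ℂ :=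
  ∑ i ∈ D, (t i : ℂ) • vecMulVec (v i) (star (v i))

theorem posSemidef_smul_vecMulVec [Finite κ] {r : ℝ} (hr : 0 ≤ r) (w : κ → ℂ) :
    ((r : ℂ) • vecMulVec w (star w)).PosSemidef :=
  (posSemidef_vecMulVec_self_star w).smul (by exact_mod_cast hr)

theorem posSemidef_scatter [Finite κ] (v : ι → κ → ℂ) (D : Finset ι) {t : ι → ℝ} (ht : ∀ i, 0 ≤ t i) :
    (scatter v D t).PosSemidef :=
  posSemidef_sum _ fun i _ => posSemidef_smul_vecMulVec (ht i) _

variable [Fintype κ] [DecidableEq κ]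

theorem det_add_smul_vecMulVec {M : Matrix κ κ ℂ} (hM : M.PosDef) (r : ℂ) (w : κ → ℂ) :
    (M + r • vecMulVec w (star w)).det = M.det * (1 + r * (star w ⬝ᵥ M⁻¹ *ᵥ w)) := by
  rw [vecMulVec_eq Unit, ← Matrix.smul_mul, det_add_mul _ _ hM.det_pos.ne'.isUnit]
  congr 1
  rw [det_unique]
  simp [Matrix.mul_apply, dotProduct, mulVec, Finset.sum_mul, Finset.mul_sum]
  rw [Finset.sum_comm]
  refine Finset.sum_congr rfl fun i _ => Finset.sum_congr rfl fun j _ => by ring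

theorem Matrix.PosDef.det_re_pos {M : Matrix κ κ ℂ} (hM : M.PosDef) : 0 < M.det.re :=
  (Complex.pos_iff.1 hM.det_pos).1

theorem Matrix.PosDef.ofReal_det_re {M : Matrix κ κ ℂ} (hM : M.PosDef) :
    ((M.det.re : ℝ) : ℂ) = M.det :=
  Complex.ext rfl (by simpa using (Complex.pos_iff.1 hM.det_pos).2)

theorem Matrix.PosDef.ofReal_inv_form {M : Matrix κ κ ℂ} (hM : M.PosDef) (w : κ → ℂ) :
    (((star w ⬝ᵥ M⁻¹ *ᵥ w).re : ℝ) : ℂ) = star w ⬝ᵥ M⁻¹ *ᵥ w ∧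
      0 ≤ (star w ⬝ᵥ M⁻¹ *ᵥ w).re := by
  have h := Complex.nonneg_iff.1 (hM.inv.posSemidef.dotProduct_mulVec_nonneg w)
  exact ⟨Complex.ext rfl (by simpa using h.2), h.1⟩

theorem det_add_smul_vecMulVec_re {M : Matrix κ κ ℂ} (hM : M.PosDef) (r : ℝ) (w : κ → ℂ) :
    (M + (r : ℂ) • vecMulVec w (star w)).det.re =
      M.det.re * (1 + r * (star w ⬝ᵥ M⁻¹ *ᵥ w).re) := by
  rw [det_add_smul_vecMulVec hM, ← (hM.ofReal_inv_form w).1, ← hM.ofReal_det_re]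
  norm_cast

theorem det_re_le_det_add_scatter {M : Matrix κ κ ℂ} (hM : M.PosDef) (v : ι → κ → ℂ)
    (D : Finset ι) {t : ι → ℝ} (ht : ∀ i, 0 ≤ t i) :
    M.det.re ≤ (M + scatter v D t).det.re := by
  classical
  induction D using Finset.induction_on with
  | empty => simp [scatter]
  | insert a D ha ih =>
    have hP : (M + scatter v D t).PosDef := hM.add_posSemidef (posSemidef_scatter v D ht)
    have : M + scatter v (insert a D) t =
        (M + scatter v D t) + (t a : ℂ) • vecMulVec (v a) (star (v a)) := by
      rw [scatter, scatter, Finset.sum_insert ha]; abel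
    rw [this, det_add_smul_vecMulVec_re hP]
    have h1 := mul_nonneg (ht a) (hP.ofReal_inv_form (v a)).2
    nlinarith [hP.det_re_pos]

theorem exists_det_scatter_basis (v : ι → κ → ℂ) (B : Finset ι) (hcard : B.card = Fintype.card κ)
    (hB : LinearIndepOn ℂ v (B : Set ι)) :
    ∃ C : ℝ, 0 < C ∧ ∀ t : ι → ℝ, (scatter v B t).det = ((C * ∏ i ∈ B, t i : ℝ) : ℂ) := by
  let e : κ ≃ B := Fintype.equivOfCardEq (by simp [hcard])
  let A : Matrix κ κ ℂ := of fun k => v (e k)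
  have hA : A.det ≠ 0 := by
    have hli : LinearIndependent ℂ A.row := (hB.comp e e.injective :)
    exact (isUnit_iff_isUnit_det A).1 (linearIndependent_rows_iff_isUnit.1 hli) |>.ne_zero
  refine ⟨Complex.normSq A.det, Complex.normSq_pos.2 hA, fun t => ?_⟩
  have : scatter v B t = Aᵀ * diagonal (fun k => (t (e k) : ℂ)) * Aᵀᴴ := by
    ext a b
    rw [scatter, ← Finset.sum_coe_sort, ← Equiv.sum_comp e]
    simp [Matrix.sum_apply, Matrix.mul_apply, diagonal_apply, vecMulVec_apply, A]
    refine Finset.sum_congr rfl fun k _ => by ring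
  have hprod : ∏ i ∈ B, t i = ∏ k, t (e k) := by
    rw [← Finset.prod_coe_sort, ← Equiv.prod_comp e]
  rw [this, det_mul, det_mul, det_conjTranspose, det_transpose, det_diagonal, hprod]
  push_cast
  rw [Complex.normSq_eq_conj_mul_self]
  simp only [Complex.star_def]
  ring

theorem posDef_scatter (v : ι → κ → ℂ) {B D : Finset ι} (hcard : B.card = Fintype.card κ)
    (hB : LinearIndepOn ℂ v (B : Set ι)) (hBD : B ⊆ D) {t : ι → ℝ} (ht : ∀ i, 0 < t i) :
    (scatter v B t).PosDef ∧ (scatter v D t).PosDef ∧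
      (scatter v B t).det.re ≤ (scatter v D t).det.re := by
  classical
  obtain ⟨C, hC, hdet⟩ := exists_det_scatter_basis v B hcard hB
  have h1 : (scatter v B t).PosDef := by
    rw [(posSemidef_scatter v B fun i => (ht i).le).posDef_iff_det_ne_zero, hdet]
    exact_mod_cast (mul_pos hC (Finset.prod_pos fun i _ => ht i)).ne'
  have h2 : scatter v D t = scatter v B t + scatter v (D \ B) t := by
    rw [scatter, scatter, scatter, add_comm, Finset.sum_sdiff hBD]
  refine ⟨h1, ?_, ?_⟩
  · rw [h2]; exact h1.add_posSemidef (posSemidef_scatter _ _ fun i => (ht i).le)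
  · rw [h2]; exact det_re_le_det_add_scatter h1 _ _ fun i => (ht i).le

end Scatter

section Scaling
open Matrix
open scoped ComplexOrder MatrixOrder

open Classical in
theorem exists_scaling {m n : ℕ} (hn : 0 < n) (v : Fin m → Fin n → ℂ)
    (hv : ∀ i, v i ≠ 0) (hspan : Submodule.span ℂ (Set.range v) = ⊤)
    (hden : ∀ U : Submodule ℂ (Fin n → ℂ), U ≠ ⊥ → U ≠ ⊤ →
      n * (Finset.univ.filter fun i => v i ∈ U).card < m * finrank ℂ U) :
    ∃ t : Fin m → ℝ, (∀ i, 0 < t i) ∧ (scatter v Finset.univ t).PosDef ∧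
      ∀ i, t i * (star (v i) ⬝ᵥ (scatter v Finset.univ t)⁻¹ *ᵥ v i).re = (n / m : ℝ) := by
  have hfr : finrank ℂ (Fin n → ℂ) = n := by simp
  have hm : 0 < m := by
    rcases Nat.eq_zero_or_pos m with rfl | h
    · exfalso
      rw [Set.range_eq_empty, Submodule.span_empty] at hspan
      have := finrank_top ℂ (Fin n → ℂ)
      rw [← hspan, finrank_bot, hfr] at this
      omega
    · exact h
  have hmR : (0 : ℝ) < m := by exact_mod_cast hm
  have hgap := exists_basis_weight_gap (K := ℂ) (by rw [hfr]; exact hn) v hv hspan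
    (by rw [hfr]; exact hden)
  rw [hfr] at hgap
  set c : ℝ := n / m with hc
  let F : (Fin m → ℝ) → Matrix (Fin n) (Fin n) ℂ :=
    fun s => scatter v Finset.univ fun i => Real.exp (s i)
  have hF : ∀ s, (F s).PosDef := fun s => by
    obtain ⟨B, hB, hcard, -⟩ := hgap s
    exact (posDef_scatter v (by simpa using hcard) hB (Finset.subset_univ _)
      fun i => Real.exp_pos _).2.1
  let φ : (Fin m → ℝ) → ℝ := fun s => Real.log (F s).det.re - c * ∑ i, s i
  have hφ : Continuous φ := by
    have hFc : Continuous F := by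
      simp only [F, scatter]
      fun_prop
    refine Continuous.sub (Continuous.log (Complex.continuous_re.comp hFc.matrix_det)
      fun s => (hF s).det_re_pos.ne') (by fun_prop)
  have hCex : ∀ B : Finset (Fin m), ∃ C : ℝ, 0 < C ∧ (B.card = n →
      LinearIndepOn ℂ v (B : Set (Fin m)) →
        ∀ t : Fin m → ℝ, (scatter v B t).det = ((C * ∏ i ∈ B, t i : ℝ) : ℂ)) := fun B => by
    by_cases h : B.card = n ∧ LinearIndepOn ℂ v (B : Set (Fin m))
    · obtain ⟨C, hC, hdet⟩ := exists_det_scatter_basis v B (by simpa using h.1) h.2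
      exact ⟨C, hC, fun _ _ => hdet⟩
    · exact ⟨1, one_pos, fun h1 h2 => absurd ⟨h1, h2⟩ h⟩
  choose C hC hCdet using hCex
  obtain ⟨B₀, hB₀⟩ := Finite.exists_min C
  have hcoer : ∀ s i j, Real.log (C B₀) + 1 / m * (s i - s j) ≤ φ s := fun s i j => by
    obtain ⟨B, hB, hcard, hle⟩ := hgap s
    have h1 := (posDef_scatter v (by simpa using hcard) hB (Finset.subset_univ _)
      fun i => Real.exp_pos (s i)).2.2
    rw [hCdet B hcard hB, Complex.ofReal_re, ← Real.exp_sum] at h1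
    have h2 : Real.log (C B) + ∑ i ∈ B, s i ≤ Real.log (F s).det.re := by
      rw [← Real.log_exp (∑ i ∈ B, s i), ← Real.log_mul (hC B).ne' (Real.exp_pos _).ne']
      exact Real.log_le_log (mul_pos (hC B) (Real.exp_pos _)) h1
    have h3 := Real.log_le_log (hC B₀) (hB₀ B)
    have h4 := hle i j
    simp only [φ]
    linarith
  have hshift : ∀ s (a : ℝ), φ (fun i => s i - a) = φ s := fun s a => by
    have h1 : F (fun i => s i - a) = ((Real.exp (-a) : ℝ) : ℂ) • F s := by
      simp only [F, scatter, Finset.smul_sum, smul_smul]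
      refine Finset.sum_congr rfl fun i _ => ?_
      rw [sub_eq_add_neg, Real.exp_add]
      push_cast
      rw [mul_comm]
    have h2 : (F (fun i => s i - a)).det.re = Real.exp (-a) ^ n * (F s).det.re := by
      rw [h1, det_smul, ← (hF s).ofReal_det_re, Fintype.card_fin]
      norm_cast
    simp only [φ]
    rw [h2, Real.log_mul (by positivity) (hF s).det_re_pos.ne', Real.log_pow, Real.log_exp,
      Finset.sum_sub_distrib]
    simp only [Finset.sum_const, Finset.card_univ, Fintype.card_fin, nsmul_eq_mul, hc]
    field_simp
    ring
  have hmin : ∃ s₀, ∀ s, φ s₀ ≤ φ s := by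
    let R : ℝ := max 0 (m * (φ 0 - Real.log (C B₀)))
    have hR0 : 0 ≤ R := le_max_left _ _
    obtain ⟨s₀, -, hs₀⟩ := (isCompact_Icc (a := (0 : Fin m → ℝ)) (b := fun _ => R)).exists_isMinOn
      ⟨0, le_rfl, fun _ => hR0⟩ hφ.continuousOn
    refine ⟨s₀, fun s => ?_⟩
    have : Nonempty (Fin m) := ⟨⟨0, hm⟩⟩
    obtain ⟨j, hj⟩ := Finite.exists_min s
    by_cases hbox : ∀ i, s i - s j ≤ R
    · rw [← hshift s (s j)]
      exact hs₀ ⟨fun i => sub_nonneg.2 (hj i), hbox⟩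
    · push Not at hbox
      obtain ⟨i, hi⟩ := hbox
      have h1 := hcoer s i j
      have h2 : φ s₀ ≤ φ 0 := hs₀ ⟨le_rfl, fun _ => hR0⟩
      have h3 : m * (φ 0 - Real.log (C B₀)) ≤ s i - s j := (le_max_right _ _).trans hi.le
      have h4 : φ 0 - Real.log (C B₀) ≤ 1 / m * (s i - s j) := by
        rw [one_div, inv_mul_eq_div, le_div_iff₀ hmR]; linarith
      linarith
  obtain ⟨s₀, hs₀⟩ := hmin
  refine ⟨fun i => Real.exp (s₀ i), fun i => Real.exp_pos _, hF s₀, fun i => ?_⟩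
  change Real.exp (s₀ i) * (star (v i) ⬝ᵥ (F s₀)⁻¹ *ᵥ v i).re = c
  set ℓ := Real.exp (s₀ i) * (star (v i) ⬝ᵥ (F s₀)⁻¹ *ᵥ v i).re with hℓ
  have hline : ∀ h : ℝ, Real.exp (c * h) ≤ 1 + (Real.exp h - 1) * ℓ := fun h => by
    have h1 : F (Function.update s₀ i (s₀ i + h)) = F s₀ +
        ((Real.exp (s₀ i) * (Real.exp h - 1) : ℝ) : ℂ) • vecMulVec (v i) (star (v i)) := by
      simp only [F, scatter]
      rw [← Finset.add_sum_erase _ _ (Finset.mem_univ i),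
        ← Finset.add_sum_erase _ (fun j => ((Real.exp (s₀ j) : ℝ) : ℂ) • _) (Finset.mem_univ i)]
      have : ∀ j ∈ Finset.univ.erase i, ((Real.exp (Function.update s₀ i (s₀ i + h) j) : ℝ) : ℂ) •
          vecMulVec (v j) (star (v j)) =
          ((Real.exp (s₀ j) : ℝ) : ℂ) • vecMulVec (v j) (star (v j)) := fun j hj => by
        rw [Function.update_of_ne (Finset.ne_of_mem_erase hj)]
      rw [Finset.sum_congr rfl this, Function.update_self, add_right_comm, ← add_smul]
      congr 2
      rw [Real.exp_add]
      push_cast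
      ring
    have h2 : ∑ j, Function.update s₀ i (s₀ i + h) j = ∑ j, s₀ j + h := by
      rw [Finset.sum_update_of_mem (Finset.mem_univ i),
        ← Finset.add_sum_erase _ _ (Finset.mem_univ i), Finset.sdiff_singleton_eq_erase]
      ring
    have h3 := (hF (Function.update s₀ i (s₀ i + h))).det_re_pos
    have h4 : (F (Function.update s₀ i (s₀ i + h))).det.re =
        (F s₀).det.re * (1 + (Real.exp h - 1) * ℓ) := by
      rw [h1, det_add_smul_vecMulVec_re (hF s₀), hℓ]; ring
    have h5 : 0 < 1 + (Real.exp h - 1) * ℓ := by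
      rw [h4] at h3
      exact pos_of_mul_pos_right h3 (hF s₀).det_re_pos.le
    have h6 := hs₀ (Function.update s₀ i (s₀ i + h))
    simp only [φ] at h6
    rw [h4, h2, Real.log_mul (hF s₀).det_re_pos.ne' h5.ne'] at h6
    rw [← Real.le_log_iff_exp_le h5]
    linarith
  let f : ℝ → ℝ := fun h => 1 + (Real.exp h - 1) * ℓ - Real.exp (c * h)
  have hf : HasDerivAt f (Real.exp 0 * ℓ - Real.exp (c * 0) * (c * 1)) 0 :=
    ((((Real.hasDerivAt_exp 0).sub_const 1).mul_const ℓ).const_add 1).sub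
      (((hasDerivAt_id (0 : ℝ)).const_mul c).exp)
  have hfmin : IsLocalMin f 0 := Filter.Eventually.of_forall fun h => by
    have := hline h
    simp only [f]
    simp
    linarith
  have := hfmin.hasDerivAt_eq_zero hf
  simp at this
  linarith

end Scaling

section PairWeights

theorem card_sq_le_sum_norm_inner_sq {F ι : Type*} [NormedAddCommGroup F] [InnerProductSpace ℂ F]
    [FiniteDimensional ℂ F] [Fintype ι] (hF : finrank ℂ F ≤ 2) (u : ι → F) (hu : ∀ i, ‖u i‖ = 1) :
    (Fintype.card ι : ℝ) ^ 2 / 2 ≤ ∑ i, ∑ j, ‖inner ℂ (u i) (u j)‖ ^ 2 := by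
  let b := stdOrthonormalBasis ℂ F
  let x : ι → Fin (finrank ℂ F) → ℂ := fun i k => inner ℂ (b k) (u i)
  let z : Fin (finrank ℂ F) → Fin (finrank ℂ F) → ℂ := fun k l => ∑ i, star (x i k) * x i l
  have hinner : ∀ i j, inner ℂ (u i) (u j) = ∑ k, star (x i k) * x j k := fun i j => by
    rw [← b.sum_inner_mul_inner (u i) (u j)]
    simp [x]
  have hsq : ∀ w : ℂ, ((‖w‖ ^ 2 : ℝ) : ℂ) = w * star w := fun w => by
    rw [← Complex.normSq_eq_norm_sq, ← Complex.mul_conj]; rfl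
  have hswap : ∑ i, ∑ j, ‖inner ℂ (u i) (u j)‖ ^ 2 = ∑ k, ∑ l, ‖z k l‖ ^ 2 := by
    apply Complex.ofReal_injective
    push_cast
    have h1 : ∀ i j, ((‖inner ℂ (u i) (u j)‖ : ℂ)) ^ 2 =
        ∑ k, ∑ l, (star (x i k) * x i l) * (x j k * star (x j l)) := fun i j => by
      have := hsq (inner ℂ (u i) (u j))
      push_cast at this
      rw [this, hinner, star_sum, Finset.sum_mul_sum]
      refine Finset.sum_congr rfl fun k _ => Finset.sum_congr rfl fun l _ => ?_
      rw [star_mul', star_star]; ring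
    have h2 : ∀ k l, ((‖z k l‖ : ℂ)) ^ 2 =
        ∑ i, ∑ j, (star (x i k) * x i l) * (x j k * star (x j l)) := fun k l => by
      have := hsq (z k l)
      push_cast at this
      rw [this, star_sum, Finset.sum_mul_sum]
      refine Finset.sum_congr rfl fun i _ => Finset.sum_congr rfl fun j _ => ?_
      rw [star_mul', star_star]
    simp_rw [h1, h2]
    rw [Finset.sum_congr rfl fun i _ => Finset.sum_comm, Finset.sum_comm]
    refine Finset.sum_congr rfl fun k _ => ?_
    rw [Finset.sum_congr rfl fun i _ => Finset.sum_comm, Finset.sum_comm]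
  have hdiag : ∑ k, ‖z k k‖ = Fintype.card ι := by
    have h1 : ∀ k, ‖z k k‖ = ∑ i, ‖x i k‖ ^ 2 := fun k => by
      have : z k k = ((∑ i, ‖x i k‖ ^ 2 : ℝ) : ℂ) := by
        rw [Complex.ofReal_sum]
        exact Finset.sum_congr rfl fun i _ => by rw [hsq, mul_comm]
      rw [this, Complex.norm_of_nonneg (by positivity)]
    simp_rw [h1]
    rw [Finset.sum_comm]
    have h2 : ∀ i, ∑ k, ‖x i k‖ ^ 2 = 1 := fun i => by
      rw [b.sum_sq_norm_inner_right, hu, one_pow]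
    simp [h2]
  rw [hswap]
  have hcs := sq_sum_le_card_mul_sum_sq (s := Finset.univ) (f := fun k => ‖z k k‖)
  rw [hdiag, Finset.card_univ, Fintype.card_fin] at hcs
  have hle : ∑ k, ‖z k k‖ ^ 2 ≤ ∑ k, ∑ l, ‖z k l‖ ^ 2 :=
    Finset.sum_le_sum fun k _ => Finset.single_le_sum (f := fun l => ‖z k l‖ ^ 2)
      (fun l _ => by positivity) (Finset.mem_univ k)
  have hF' : (finrank ℂ F : ℝ) ≤ 2 := by exact_mod_cast hF
  have hnn : 0 ≤ ∑ k, ‖z k k‖ ^ 2 := Finset.sum_nonneg fun k _ => by positivity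
  nlinarith

open Matrix
open scoped ComplexOrder MatrixOrder

open Classical in
theorem exists_pair_weights {m n : ℕ} (hn : 0 < n) (v : Fin m → Fin n → ℂ)
    (hv : ∀ i, v i ≠ 0) (hspan : Submodule.span ℂ (Set.range v) = ⊤)
    (hden : ∀ U : Submodule ℂ (Fin n → ℂ), U ≠ ⊥ → U ≠ ⊤ →
      n * (Finset.univ.filter fun i => v i ∈ U).card < m * finrank ℂ U) :
    ∃ p : Fin m → Fin m → ℝ, (∀ i j, 0 ≤ p i j) ∧ (∀ i j, p i j ≤ 1) ∧
      ∑ i, ∑ j, p i j = (m : ℝ) ^ 2 / n ∧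
      ∀ S : Finset (Fin m), finrank ℂ (Submodule.span ℂ (v '' (S : Set (Fin m)))) ≤ 2 →
        (S.card : ℝ) ^ 2 / 2 ≤ ∑ i ∈ S, ∑ j ∈ S, p i j := by
  obtain ⟨t, ht, hM, hlev⟩ := exists_scaling hn v hv hspan hden
  set M := scatter v Finset.univ t with hMdef
  obtain ⟨R, hR⟩ := CStarAlgebra.nonneg_iff_eq_star_mul_self.mp hM.inv.posSemidef.nonneg
  rcases Nat.eq_zero_or_pos m with rfl | hm
  · exact ⟨fun _ _ => 0, by simp, by simp, by simp, fun S _ => by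
      rw [Finset.eq_empty_of_isEmpty S]; simp⟩
  have hc : (0 : ℝ) < n / m := by positivity
  set c : ℝ := n / m with hcdef
  let a : Fin m → ℂ := fun i => (Real.sqrt (t i / c) : ℝ)
  have ha : ∀ i, a i * star (a i) = (t i / c : ℝ) := fun i => by
    have h := Real.mul_self_sqrt (div_nonneg (ht i).le hc.le)
    simp only [a, Complex.star_def, Complex.conj_ofReal]
    exact_mod_cast h
  let T : (Fin n → ℂ) →ₗ[ℂ] EuclideanSpace ℂ (Fin n) :=
    (WithLp.linearEquiv 2 ℂ (Fin n → ℂ)).symm.toLinearMap ∘ₗ R.mulVecLin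
  let u : Fin m → EuclideanSpace ℂ (Fin n) := fun i => a i • T (v i)
  have hinner : ∀ x y, inner ℂ (T x) (T y) = star x ⬝ᵥ M⁻¹ *ᵥ y := fun x y => by
    rw [hR, ← mulVec_mulVec, Matrix.star_eq_conjTranspose, dotProduct_mulVec,
      ← star_mulVec, dotProduct_comm]
    rfl
  have hu : ∀ i, ‖u i‖ = 1 := fun i => by
    have h1 : inner ℂ (u i) (u i) = 1 := by
      simp only [u]
      rw [inner_smul_left, inner_smul_right, hinner, ← mul_assoc, mul_comm (starRingEnd ℂ _),
        ← Complex.star_def, ha, ← (hM.ofReal_inv_form (v i)).1, ← Complex.ofReal_mul,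
        div_mul_eq_mul_div, hlev, div_self hc.ne', Complex.ofReal_one]
    have h2 : ‖u i‖ ^ 2 = 1 := by rw [norm_sq_eq_re_inner (𝕜 := ℂ), h1]; simp
    nlinarith [norm_nonneg (u i)]
  have hpars : ∀ j, ∑ i, ‖inner ℂ (u i) (u j)‖ ^ 2 = 1 / c := fun j => by
    apply Complex.ofReal_injective
    have h1 : ∀ i, ((‖inner ℂ (u i) (u j)‖ ^ 2 : ℝ) : ℂ) = (t j / c : ℝ) * (1 / c : ℝ) *
        (star (v j) ⬝ᵥ M⁻¹ *ᵥ (((t i : ℂ) • vecMulVec (v i) (star (v i))) *ᵥ (M⁻¹ *ᵥ v j))) :=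
      fun i => by
        have h2 : ((‖inner ℂ (u i) (u j)‖ ^ 2 : ℝ) : ℂ) =
            inner ℂ (u j) (u i) * inner ℂ (u i) (u j) := by
          rw [← inner_conj_symm (u j) (u i), ← Complex.normSq_eq_norm_sq,
            Complex.normSq_eq_conj_mul_self]
        rw [h2]
        simp only [u, inner_smul_left, inner_smul_right, hinner]
        rw [smul_mulVec, vecMulVec_mulVec, mulVec_smul, dotProduct_smul]
        simp only [mulVec_smul, dotProduct_smul, smul_eq_mul, op_smul_eq_smul]
        have h3 := ha i
        have h4 := ha j
        simp only [Complex.star_def] at h3 h4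
        push_cast at h3 h4 ⊢
        linear_combination (star (v j) ⬝ᵥ M⁻¹ *ᵥ v i) * (star (v i) ⬝ᵥ M⁻¹ *ᵥ v j) *
          (a j * (starRingEnd ℂ) (a j) * h3 + (t i / c : ℂ) * h4)
    push_cast at h1 ⊢
    simp_rw [h1]
    rw [← Finset.mul_sum, ← dotProduct_sum, ← mulVec_sum, ← sum_mulVec]
    change _ * (star (v j) ⬝ᵥ M⁻¹ *ᵥ (M *ᵥ (M⁻¹ *ᵥ v j))) = _
    rw [mulVec_mulVec (v j) M, mul_nonsing_inv _ hM.det_pos.ne'.isUnit, one_mulVec,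
      ← (hM.ofReal_inv_form (v j)).1]
    have h5 := hlev j
    have h6 : t j / c * (1 / c) * (star (v j) ⬝ᵥ M⁻¹ *ᵥ v j).re = 1 / c := by
      field_simp; linarith
    exact_mod_cast h6
  refine ⟨fun i j => ‖inner ℂ (u i) (u j)‖ ^ 2, fun i j => by positivity, fun i j => ?_, ?_, ?_⟩
  · have := norm_inner_le_norm (𝕜 := ℂ) (u i) (u j)
    rw [hu, hu, one_mul] at this
    exact pow_le_one₀ (norm_nonneg _) this
  · rw [Finset.sum_comm]
    simp_rw [hpars]
    simp [hcdef]
    field_simp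
  · intro S hS
    let F := (Submodule.span ℂ (v '' (S : Set (Fin m)))).map T
    have hF : finrank ℂ F ≤ 2 := (Submodule.finrank_map_le _ _).trans hS
    have hmem : ∀ i : S, u i ∈ F := fun i =>
      F.smul_mem _ ⟨_, Submodule.subset_span ⟨i, i.2, rfl⟩, rfl⟩
    have := card_sq_le_sum_norm_inner_sq hF (fun i : S => (⟨u i, hmem i⟩ : F)) fun i => hu i
    simp only [Fintype.card_coe, Submodule.coe_inner] at this
    rw [← Finset.sum_coe_sort S]
    simp_rw [← Finset.sum_coe_sort S (fun j => ‖inner ℂ (u _) (u j)‖ ^ 2)]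
    exact this

end PairWeights

section LineCounting

open Classical in
/-- In a finite set with classes `key ⁻¹ {a}` whose sizes grow with `key`, the number of pairs
`key i < key j` with `key j` not maximal is controlled by the weights of pairs in different
classes, as soon as every subset carries at least half of its squared size as weight. -/
theorem card_nonmaximal_pairs_le {ι : Type*} (A : Finset ι) (key : ι → ℕ) (p : ι → ι → ℝ)
    (hp0 : ∀ i j, 0 ≤ p i j) (hp1 : ∀ i j, p i j ≤ 1)
    (hS : ∀ S ⊆ A, (S.card : ℝ) ^ 2 / 2 ≤ ∑ i ∈ S, ∑ j ∈ S, p i j)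
    (hmono : ∀ i ∈ A, ∀ j ∈ A, key i < key j →
      (A.filter fun x => key x = key i).card ≤ (A.filter fun x => key x = key j).card) :
    (((A ×ˢ A).filter fun x => key x.1 < key x.2 ∧ ∃ k ∈ A, key x.2 < key k).card : ℝ) ≤
      2 * ∑ x ∈ (A ×ˢ A).filter fun x => key x.1 ≠ key x.2, p x.1 x.2 := by
  rcases Finset.eq_empty_or_nonempty
    ((A ×ˢ A).filter fun x => key x.1 < key x.2 ∧ ∃ k ∈ A, key x.2 < key k) with he | ⟨x₀, hx₀⟩
  · rw [he]
    have := Finset.sum_nonneg (s := (A ×ˢ A).filter fun x => key x.1 ≠ key x.2)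
      fun x _ => hp0 x.1 x.2
    simpa using this
  simp only [Finset.mem_filter, Finset.mem_product] at hx₀
  obtain ⟨⟨hi₀, hj₀⟩, -, k₀, hk₀, hjk₀⟩ := hx₀
  obtain ⟨a, haA, ha⟩ := A.exists_max_image key ⟨_, hk₀⟩
  let B := A.filter fun x => key x < key a
  have hBne : B.Nonempty := ⟨x₀.2, by
    simp only [B, Finset.mem_filter]; exact ⟨hj₀, hjk₀.trans_le (ha _ hk₀)⟩⟩
  obtain ⟨b, hbB, hb⟩ := B.exists_max_image key hBne
  obtain ⟨hbA, hba⟩ := Finset.mem_filter.1 hbB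
  let X := B.filter fun x => key x < key b
  let c := (A.filter fun x => key x = key b).card
  obtain ⟨T, hTsub, hTc⟩ := Finset.exists_subset_card_eq (hmono b hbA a haA hba)
  have hBc : B.card = X.card + c := by
    rw [← Finset.card_filter_add_card_filter_not (s := B) fun x => key x < key b]
    congr 2
    ext x
    simp only [B, Finset.mem_filter]
    constructor
    · rintro ⟨⟨h1, h2⟩, h3⟩
      exact ⟨h1, le_antisymm (hb x (Finset.mem_filter.2 ⟨h1, h2⟩)) (not_lt.1 h3)⟩
    · rintro ⟨h1, h2⟩
      exact ⟨⟨h1, h2 ▸ hba⟩, by omega⟩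
  have hTkey : ∀ x ∈ T, key x = key a := fun x hx => (Finset.mem_filter.1 (hTsub hx)).2
  have hdisj : Disjoint T B := Finset.disjoint_left.2 fun x hx hxB => by
    have h1 := hTkey x hx
    have h2 := (Finset.mem_filter.1 hxB).2
    omega
  let S := T ∪ B
  have hSA : S ⊆ A := Finset.union_subset
    (hTsub.trans (Finset.filter_subset _ _)) (Finset.filter_subset _ _)
  have hScard : S.card = c + (X.card + c) := by
    rw [Finset.card_union_of_disjoint hdisj, hTc, hBc]
  have hclass : ∀ i ∈ S, (S.filter fun j => key i = key j).card ≤ c := fun i hi => by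
    by_cases hia : key i = key a
    · refine le_trans (Finset.card_le_card fun x hx => ?_) hTc.le
      obtain ⟨h1, h2⟩ := Finset.mem_filter.1 hx
      rcases Finset.mem_union.1 h1 with h | h
      · exact h
      · have := (Finset.mem_filter.1 h).2
        omega
    · have hiB : i ∈ B := (Finset.mem_union.1 hi).resolve_left fun h => hia (hTkey i h)
      have hle : (A.filter fun x => key x = key i).card ≤ c := by
        rcases (hb i hiB).lt_or_eq with h | h
        · exact hmono i (hSA hi) b hbA h
        · exact (congrArg Finset.card (Finset.filter_congr fun x _ => by rw [h])).le
      refine le_trans (Finset.card_le_card fun x hx => ?_) hle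
      obtain ⟨h1, h2⟩ := Finset.mem_filter.1 hx
      exact Finset.mem_filter.2 ⟨hSA h1, h2.symm⟩
  have hpar : ∑ x ∈ (S ×ˢ S).filter (fun x => ¬ key x.1 ≠ key x.2), p x.1 x.2 ≤
      (S.card : ℝ) * c := by
    calc _ ≤ ∑ x ∈ (S ×ˢ S).filter (fun x => ¬ key x.1 ≠ key x.2), (1 : ℝ) :=
          Finset.sum_le_sum fun x _ => hp1 _ _
      _ = ∑ i ∈ S, ((S.filter fun j => key i = key j).card : ℝ) := by
          simp only [not_not]
          rw [Finset.sum_filter, Finset.sum_product]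
          simp
      _ ≤ ∑ i ∈ S, (c : ℝ) := Finset.sum_le_sum fun i hi => by exact_mod_cast hclass i hi
      _ = _ := by simp
  have hnonpar : ∑ x ∈ (S ×ˢ S).filter (fun x => key x.1 ≠ key x.2), p x.1 x.2 ≤
      ∑ x ∈ (A ×ˢ A).filter (fun x => key x.1 ≠ key x.2), p x.1 x.2 :=
    Finset.sum_le_sum_of_subset_of_nonneg
      (Finset.filter_subset_filter _ (Finset.product_subset_product hSA hSA))
      fun x _ _ => hp0 _ _
  have hsplit := Finset.sum_filter_add_sum_filter_not (S ×ˢ S)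
    (fun x => key x.1 ≠ key x.2) fun x => p x.1 x.2
  have hS' := hS S hSA
  rw [← Finset.sum_product'] at hS'
  have hsub : ((A ×ˢ A).filter fun x => key x.1 < key x.2 ∧ ∃ k ∈ A, key x.2 < key k) ⊆
      X ×ˢ B := fun x hx => by
    simp only [Finset.mem_filter, Finset.mem_product] at hx
    obtain ⟨⟨h1, h2⟩, h3, k, hk, h4⟩ := hx
    have hxB : x.2 ∈ B := Finset.mem_filter.2 ⟨h2, h4.trans_le (ha k hk)⟩
    have h5 := hb _ hxB
    exact Finset.mem_product.2
      ⟨Finset.mem_filter.2 ⟨Finset.mem_filter.2 ⟨h1, by omega⟩, by omega⟩, hxB⟩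
  have hcard := Finset.card_le_card hsub
  rw [Finset.card_product, hBc] at hcard
  have hcard' : (((A ×ˢ A).filter fun x => key x.1 < key x.2 ∧ ∃ k ∈ A, key x.2 < key k).card : ℝ)
      ≤ X.card * (X.card + c) := by exact_mod_cast hcard
  rw [hScard] at hpar hS'
  push_cast at hpar hS'
  have hXc : (0 : ℝ) ≤ X.card * c := by positivity
  nlinarith

variable {K F ι : Type*} [Field K] [AddCommGroup F] [Module K F] [Fintype ι]

open Classical in
/-- A numbering of the values of `r` in the order of the sizes of their fibres. -/
theorem exists_key_monotone_card {α : Type*} (r : ι → α) :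
    ∃ key : ι → ℕ, (∀ i j, key i = key j ↔ r i = r j) ∧
      ∀ i j, key i < key j → (Finset.univ.filter fun x => r x = r i).card ≤
        (Finset.univ.filter fun x => r x = r j).card := by
  let e := Finite.equivFin (Set.range r)
  let N := Nat.card (Set.range r)
  let f : ι → Fin N := fun i => e ⟨r i, Set.mem_range_self i⟩
  have hf : ∀ i j, f i = f j ↔ r i = r j := fun i j => by
    rw [e.injective.eq_iff, Subtype.mk_eq_mk]
  have hlt : ∀ i, (f i : ℕ) < N := fun i => (f i).2
  refine ⟨fun i => (Finset.univ.filter fun x => r x = r i).card * N + f i, fun i j => ?_,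
    fun i j h => ?_⟩
  · constructor
    · intro h
      have h1 := congrArg (· % N) h
      simp only [Nat.mul_add_mod', Nat.mod_eq_of_lt (hlt _)] at h1
      exact (hf i j).1 (Fin.ext h1)
    · intro h
      simp only [h, (hf i j).2 h]
  · by_contra! hc
    have h1 := Nat.mul_le_mul_right N (Nat.succ_le_of_lt hc)
    have h2 := hlt j
    rw [Nat.succ_mul] at h1
    dsimp only at h
    omega

open Classical in
theorem card_pairs_le_two_mul_sum {w : ι → F} (hw : ∀ i, w i ≠ 0) (key : ι → ℕ)
    (hkey : ∀ i j, key i = key j ↔ Submodule.span K {w i} = Submodule.span K {w j})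
    (hmono : ∀ i j, key i < key j →
      (Finset.univ.filter fun x => key x = key i).card ≤
        (Finset.univ.filter fun x => key x = key j).card)
    (p : ι → ι → ℝ) (hp0 : ∀ i j, 0 ≤ p i j) (hp1 : ∀ i j, p i j ≤ 1)
    (hS : ∀ S : Finset ι, finrank K (Submodule.span K (w '' (S : Set ι))) ≤ 2 →
      (S.card : ℝ) ^ 2 / 2 ≤ ∑ i ∈ S, ∑ j ∈ S, p i j) :
    ((Finset.univ.filter fun x : ι × ι => key x.1 < key x.2 ∧
      ∃ k, key x.2 < key k ∧ w k ∈ Submodule.span K {w x.1, w x.2}).card : ℝ) ≤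
      2 * ∑ i, ∑ j, p i j := by
  let f : ι × ι → Submodule K F := fun x => Submodule.span K {w x.1, w x.2}
  set P := Finset.univ.filter fun x : ι × ι => key x.1 < key x.2 ∧
      ∃ k, key x.2 < key k ∧ w k ∈ Submodule.span K {w x.1, w x.2} with hP
  have hrank : ∀ x, finrank K (f x) ≤ 2 := fun x => by
    have := finrank_span_finset_le_card (R := K) ({w x.1, w x.2} : Finset F)
    rw [Finset.coe_pair] at this
    exact this.trans Finset.card_le_two
  have hfin : ∀ x, FiniteDimensional K (f x) := fun x =>
    FiniteDimensional.span_of_finite K (Set.toFinite _)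
  have hline : ∀ x i j, w i ∈ f x → w j ∈ f x → key i ≠ key j → f (i, j) = f x := by
    intro x i j hi hj hij
    have hle : f (i, j) ≤ f x := Submodule.span_le.2 (by
      rintro y (rfl | rfl) <;> assumption)
    refine Submodule.eq_of_le_of_finrank_le hle ((hrank x).trans ?_)
    have hli : LinearIndependent K ![w i, w j] := by
      rw [LinearIndependent.pair_iff' (hw i)]
      intro a ha
      refine hij ((hkey i j).2 ?_)
      rw [← ha, Submodule.span_singleton_smul_eq]
      refine IsUnit.mk0 a ?_
      rintro rfl
      exact hw j (by rw [← ha, zero_smul])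
    have := finrank_span_eq_card hli
    rw [Matrix.range_cons, Matrix.range_cons, Matrix.range_empty, Set.union_empty,
      Set.singleton_union, Fintype.card_fin] at this
    exact this.ge
  have hPcard : P.card = ∑ L ∈ Finset.univ.image f, (P.filter fun x => f x = L).card :=
    Finset.card_eq_sum_card_fiberwise fun x _ => Finset.mem_coe.2
      (Finset.mem_image_of_mem f (Finset.mem_univ x))
  have hsum : ∑ i, ∑ j, p i j = ∑ L ∈ Finset.univ.image f,
      ∑ x ∈ Finset.univ.filter (fun x => f x = L), p x.1 x.2 := by
    rw [Finset.sum_fiberwise_of_maps_to fun x _ => Finset.mem_image_of_mem f (Finset.mem_univ x),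
      ← Finset.sum_product', Finset.univ_product_univ]
  rw [hPcard, hsum, Finset.mul_sum]
  push_cast
  refine Finset.sum_le_sum fun L hL => ?_
  obtain ⟨x, -, rfl⟩ := Finset.mem_image.1 hL
  let A := Finset.univ.filter fun i => w i ∈ f x
  have hclass : ∀ i ∈ A, (A.filter fun y => key y = key i) =
      Finset.univ.filter fun y => key y = key i := fun i hi => by
    ext y
    simp only [A, Finset.mem_filter, Finset.mem_univ, true_and] at hi ⊢
    refine ⟨And.right, fun h => ⟨?_, h⟩⟩
    have h1 : w y ∈ Submodule.span K {w i} :=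
      (hkey y i).1 h ▸ Submodule.mem_span_singleton_self _
    exact (Submodule.span_le.2 (Set.singleton_subset_iff.2 hi)) h1
  have hmain := card_nonmaximal_pairs_le A key p hp0 hp1
    (fun S hSA => hS S ((Submodule.finrank_mono (Submodule.span_le.2 (by
      rintro _ ⟨i, hi, rfl⟩
      exact (Finset.mem_filter.1 (hSA hi)).2))).trans (hrank x)))
    (fun i hi j hj hij => by rw [hclass i hi, hclass j hj]; exact hmono i j hij)
  refine le_trans ?_ (hmain.trans (mul_le_mul_of_nonneg_left ?_ (by norm_num)))
  · refine Nat.cast_le.2 (Finset.card_le_card fun y hy => ?_)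
    simp only [hP, A, Finset.mem_filter, Finset.mem_univ, true_and, Finset.mem_product] at hy ⊢
    obtain ⟨⟨h1, k, h2, h3⟩, h4⟩ := hy
    have h5 : w y.1 ∈ f y := Submodule.subset_span (by simp)
    have h6 : w y.2 ∈ f y := Submodule.subset_span (by simp)
    rw [← h4]
    exact ⟨⟨h5, h6⟩, h1, k, h3, h2⟩
  · refine Finset.sum_le_sum_of_subset_of_nonneg (fun y hy => ?_) fun y _ _ => hp0 _ _
    simp only [A, Finset.mem_filter, Finset.mem_univ, true_and, Finset.mem_product] at hy ⊢
    exact hline x y.1 y.2 hy.1.1 hy.1.2 hy.2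

end LineCounting

section RobustSpanning

open Classical in
/-- If every vector is spanned by two of the vectors surviving the removal of any `D` of them, then
a dense spanning configuration lives in small dimension. -/
theorem sq_mul_le_of_robust_span {m n : ℕ} (hn : 0 < n) (w : Fin m → Fin n → ℂ)
    (hw : ∀ i, w i ≠ 0) (hspan : Submodule.span ℂ (Set.range w) = ⊤)
    (hden : ∀ U : Submodule ℂ (Fin n → ℂ), U ≠ ⊥ → U ≠ ⊤ →
      n * (Finset.univ.filter fun i => w i ∈ U).card < m * finrank ℂ U)
    {D : ℝ} (hD : 0 < D)
    (hrob : ∀ Δ : Finset (Fin m), (Δ.card : ℝ) ≤ D → ∀ i, ∃ a b,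
      (a = 0 ∨ ∃ j ∉ Δ, a = w j) ∧ (b = 0 ∨ ∃ k ∉ Δ, b = w k) ∧
        w i ∈ Submodule.span ℂ {a, b}) :
    D ^ 2 * n ≤ 16 * (m : ℝ) ^ 2 := by
  have hm : 0 < m := by
    rcases Nat.eq_zero_or_pos m with rfl | h
    · have : Nontrivial (Fin n → ℂ) := by
        have : Nonempty (Fin n) := ⟨⟨0, hn⟩⟩
        infer_instance
      rw [Set.range_eq_empty, Submodule.span_empty] at hspan
      exact absurd hspan bot_ne_top
    · exact h
  have hDm : D ≤ m := by
    by_contra! h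
    obtain ⟨a, b, ha, hb, hab⟩ := hrob Finset.univ (by simpa using h.le) ⟨0, hm⟩
    have ha' : a = 0 := ha.resolve_right fun ⟨j, hj, _⟩ => hj (Finset.mem_univ j)
    have hb' : b = 0 := hb.resolve_right fun ⟨j, hj, _⟩ => hj (Finset.mem_univ j)
    refine hw ⟨0, hm⟩ ?_
    simpa [ha', hb'] using hab
  obtain ⟨key, hkey, hmono⟩ := exists_key_monotone_card fun i => Submodule.span ℂ {w i}
  simp only [← hkey] at hmono
  obtain ⟨p, hp0, hp1, hpsum, hpS⟩ := exists_pair_weights hn w hw hspan hden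
  have hP := card_pairs_le_two_mul_sum hw key hkey hmono p hp0 hp1 hpS
  rw [hpsum] at hP
  set P := Finset.univ.filter fun x : Fin m × Fin m => key x.1 < key x.2 ∧
      ∃ k, key x.2 < key k ∧ w k ∈ Submodule.span ℂ {w x.1, w x.2} with hPdef
  replace hP : (P.card : ℝ) ≤ 2 * ((m : ℝ) ^ 2 / n) := by convert hP
  have hpar : ∀ i j, w i ∈ Submodule.span ℂ {w j} → key i = key j := fun i j h => by
    rw [hkey]
    obtain ⟨c, hc⟩ := Submodule.mem_span_singleton.1 h
    rw [← hc]
    refine Submodule.span_singleton_smul_eq (IsUnit.mk0 c ?_) _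
    rintro rfl
    exact hw i (by rw [← hc, zero_smul])
  have hclass : ∀ i, n * (Finset.univ.filter fun x => key x = key i).card ≤ m := fun i => by
    have hrank := finrank_span_singleton (K := ℂ) (hw i)
    have hsub : (Finset.univ.filter fun x => key x = key i) ⊆
        Finset.univ.filter fun x => w x ∈ Submodule.span ℂ {w i} := fun x hx => by
      simp only [Finset.mem_filter, Finset.mem_univ, true_and] at hx ⊢
      exact (hkey x i).1 hx ▸ Submodule.mem_span_singleton_self _
    by_cases htop : Submodule.span ℂ {w i} = ⊤
    · rw [htop, finrank_top, finrank_fin_fun] at hrank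
      rw [hrank, one_mul]
      exact (Finset.card_le_univ _).trans_eq (Fintype.card_fin m)
    · have h1 := hden _ (by simpa using hw i) htop
      rw [hrank, mul_one] at h1
      exact (Nat.mul_le_mul_left n (Finset.card_le_card hsub)).trans h1.le
  by_cases hbig : 4 * (m : ℝ) < D * n
  swap
  · nlinarith
  have hn' : (0 : ℝ) < n := by exact_mod_cast hn
  have hclass' : ∀ i, ((Finset.univ.filter fun x => key x = key i).card : ℝ) ≤ D / 4 := fun i => by
    have h1 : (n : ℝ) * (Finset.univ.filter fun x => key x = key i).card ≤ m := by
      exact_mod_cast hclass i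
    by_contra! h
    nlinarith
  let low : Fin m → Finset (Fin m) := fun i => Finset.univ.filter fun x => key x < key i
  let I := Finset.univ.filter fun i => ((low i).card : ℝ) ≤ D / 4
  have hI : D / 4 ≤ I.card := by
    by_cases h : (Finset.univ \ I).Nonempty
    · obtain ⟨i, hi, hmin⟩ := Finset.exists_min_image _ key h
      have h1 : low i ⊆ I := fun x hx => by
        by_contra hxI
        have := hmin x (by simpa using hxI)
        have := (Finset.mem_filter.1 hx).2
        omega
      have h2 : ¬ ((low i).card : ℝ) ≤ D / 4 := by simpa [I] using hi
      have h3 : ((low i).card : ℝ) ≤ I.card := by exact_mod_cast Finset.card_le_card h1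
      linarith
    · have h1 : I = Finset.univ := by
        rw [Finset.not_nonempty_iff_eq_empty, Finset.sdiff_eq_empty_iff_subset] at h
        exact Finset.univ_subset_iff.1 h
      rw [h1, Finset.card_univ, Fintype.card_fin]
      linarith
  have hdeg : ∀ i ∈ I, D / 2 ≤ ((Finset.univ.filter fun j => (i, j) ∈ P).card : ℝ) := by
    intro i hi
    by_contra! hlt
    let Δ := (Finset.univ.filter fun j => (i, j) ∈ P) ∪
      ((Finset.univ.filter fun x => key x = key i) ∪ low i)
    have hΔ : (Δ.card : ℝ) ≤ D := by
      have h1 : Δ.card ≤ _ := (Finset.card_union_le _ _).trans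
        (Nat.add_le_add_left (Finset.card_union_le _ _) _)
      have h2 : (Δ.card : ℝ) ≤ (Finset.univ.filter fun j => (i, j) ∈ P).card +
        ((Finset.univ.filter fun x => key x = key i).card + (low i).card) := by exact_mod_cast h1
      have h3 := hclass' i
      have h4 := (Finset.mem_filter.1 hi).2
      linarith
    have hout : ∀ j ∉ Δ, key i < key j ∧ (i, j) ∉ P := fun j hj => by
      simp only [Δ, low, Finset.mem_union, Finset.mem_filter, Finset.mem_univ, true_and,
        not_or] at hj
      exact ⟨by omega, hj.1⟩
    have hpair : ∀ j ∉ Δ, ∀ k ∉ Δ, key j < key k →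
        w i ∉ Submodule.span ℂ {w j, w k} := by
      intro j hj k hk hjk hmem
      refine (hout j hj).2 ?_
      simp only [hPdef, Finset.mem_filter, Finset.mem_univ, true_and]
      refine ⟨(hout j hj).1, k, hjk, ?_⟩
      refine mem_span_insert_exchange (s := {w j}) (by rwa [Set.pair_comm]) fun h => ?_
      exact (hout j hj).1.ne (hpar _ _ h)
    obtain ⟨a, b, ha, hb, hab⟩ := hrob Δ hΔ i
    rcases ha with rfl | ⟨j, hj, rfl⟩
    · rw [Submodule.span_insert_zero] at hab
      rcases hb with rfl | ⟨k, hk, rfl⟩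
      · exact hw i (by simpa using hab)
      · exact (hout k hk).1.ne (hpar _ _ hab)
    · rcases hb with rfl | ⟨k, hk, rfl⟩
      · rw [Set.pair_comm, Submodule.span_insert_zero] at hab
        exact (hout j hj).1.ne (hpar _ _ hab)
      · rcases lt_trichotomy (key j) (key k) with h | h | h
        · exact hpair j hj k hk h hab
        · have h1 : w k ∈ Submodule.span ℂ {w j} :=
            (hkey j k).1 h ▸ Submodule.mem_span_singleton_self _
          rw [Set.pair_comm, Submodule.span_insert_eq_span h1] at hab
          exact (hout j hj).1.ne (hpar _ _ hab)
        · exact hpair k hk j hj h (by rwa [Set.pair_comm])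
  have hPlow : D / 4 * (D / 2) ≤ P.card := by
    have h1 : P.card = ∑ i, (Finset.univ.filter fun j => (i, j) ∈ P).card := by
      rw [← Finset.card_sigma]
      refine Finset.card_bij' (fun x _ => ⟨x.1, x.2⟩) (fun x _ => (x.1, x.2)) ?_ ?_ ?_ ?_ <;> simp
    calc D / 4 * (D / 2) ≤ I.card * (D / 2) := by gcongr
      _ = ∑ i ∈ I, D / 2 := by simp
      _ ≤ ∑ i ∈ I, ((Finset.univ.filter fun j => (i, j) ∈ P).card : ℝ) := Finset.sum_le_sum hdeg
      _ ≤ ∑ i, ((Finset.univ.filter fun j => (i, j) ∈ P).card : ℝ) :=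
        Finset.sum_le_sum_of_subset_of_nonneg (Finset.subset_univ _) fun _ _ _ => by positivity
      _ = P.card := by rw [h1]; push_cast; rfl
  have hfin := hPlow.trans hP
  rw [← mul_div_assoc 2, le_div_iff₀ hn'] at hfin
  linarith

end RobustSpanning

section DenseQuotient

open Classical in
/-- Among the proper subspaces, one minimizing the number of outside vectors per codimension and,
in case of ties, the codimension. -/
theorem exists_submodule_min_density {K E ι : Type*} [Field K] [AddCommGroup E] [Module K E]
    [FiniteDimensional K E] [Nontrivial E] [Fintype ι] (x : ι → E) :
    ∃ W : Submodule K E, W ≠ ⊤ ∧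
      (Finset.univ.filter fun i => x i ∉ W).card * finrank K E ≤
        Fintype.card ι * finrank K (E ⧸ W) ∧
      ∀ W' : Submodule K E, W < W' → W' ≠ ⊤ →
        (Finset.univ.filter fun i => x i ∉ W).card * finrank K (E ⧸ W') <
          (Finset.univ.filter fun i => x i ∉ W').card * finrank K (E ⧸ W) := by
  let g : Submodule K E → ℕ × ℕ := fun W =>
    ((Finset.univ.filter fun i => x i ∉ W).card, finrank K (E ⧸ W))
  let f : ℕ × ℕ → ℚ ×ₗ ℕ := fun y => toLex ((y.1 : ℚ) / y.2, y.2)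
  have hfin : (g '' {W | W ≠ ⊤}).Finite := by
    refine ((Finset.range (Fintype.card ι + 1) ×ˢ
      Finset.range (finrank K E + 1)).finite_toSet).subset ?_
    rintro _ ⟨W, -, rfl⟩
    simp only [g, Finset.coe_product, Finset.coe_range, Set.mem_prod, Set.mem_Iio,
      Nat.lt_succ_iff]
    exact ⟨Finset.card_le_univ _, Submodule.finrank_quotient_le W⟩
  obtain ⟨_, ⟨W, hW, rfl⟩, hmin⟩ :=
    Set.exists_min_image _ f hfin ⟨_, ⊥, bot_ne_top, rfl⟩
  have hpos : ∀ V : Submodule K E, V ≠ ⊤ → (0 : ℚ) < finrank K (E ⧸ V) := fun V hV => by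
    have : Nontrivial (E ⧸ V) := Submodule.Quotient.nontrivial_iff.2 hV
    exact_mod_cast finrank_pos
  refine ⟨W, hW, ?_, fun W' hlt hW' => ?_⟩
  · have h1 := hmin _ ⟨⊥, bot_ne_top, rfl⟩
    have h2 : ((Finset.univ.filter fun i => x i ∉ W).card : ℚ) / finrank K (E ⧸ W) ≤
        (Finset.univ.filter fun i => x i ∉ (⊥ : Submodule K E)).card /
          finrank K (E ⧸ (⊥ : Submodule K E)) := by
      rcases Prod.Lex.toLex_le_toLex.1 h1 with h | h
      · exact h.le
      · exact h.1.le
    rw [div_le_div_iff₀ (hpos _ hW) (hpos _ bot_ne_top),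
      (Submodule.quotEquivOfEqBot ⊥ rfl).finrank_eq] at h2
    have h3 := Nat.mul_le_mul_right (finrank K (E ⧸ W))
      (Finset.card_le_univ (Finset.univ.filter fun i => x i ∉ (⊥ : Submodule K E)))
    exact le_trans (by exact_mod_cast h2) h3
  · have h1 := hmin _ ⟨W', hW', rfl⟩
    have h2 : finrank K (E ⧸ W') < finrank K (E ⧸ W) := by
      have h3 := Submodule.finrank_lt_finrank_of_lt hlt
      have h4 := W.finrank_quotient_add_finrank
      have h5 := W'.finrank_quotient_add_finrank
      omega
    have h3 : ((Finset.univ.filter fun i => x i ∉ W).card : ℚ) / finrank K (E ⧸ W) <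
        (Finset.univ.filter fun i => x i ∉ W').card / finrank K (E ⧸ W') := by
      rcases Prod.Lex.toLex_le_toLex.1 h1 with h | h
      · exact h
      · exact absurd h.2 (not_le.2 h2)
    rw [div_lt_div_iff₀ (hpos _ hW) (hpos _ hW')] at h3
    exact_mod_cast h3

open Classical in
theorem sq_mul_finrank_le_of_robust_span {E : Type*} [AddCommGroup E] [Module ℂ E]
    [FiniteDimensional ℂ E] {m : ℕ} (hm : 0 < m) (x : Fin m → E)
    (hspan : Submodule.span ℂ (Set.range x) = ⊤) {δ : ℝ} (hδ : 0 < δ)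
    (hrob : ∀ Δ : Finset (Fin m), (Δ.card : ℝ) ≤ δ * m → ∀ i, ∃ j ∉ Δ, ∃ k ∉ Δ,
      x i ∈ Submodule.span ℂ {x j, x k}) :
    δ ^ 2 * finrank ℂ E ≤ 16 := by
  rcases subsingleton_or_nontrivial E with hE | hE
  · rw [finrank_zero_of_subsingleton]; norm_num
  obtain ⟨W, hW, hWle, hWlt⟩ := exists_submodule_min_density (K := ℂ) x
  set a := (Finset.univ.filter fun i => x i ∉ W).card with ha
  set b := finrank ℂ (E ⧸ W) with hb
  have hb0 : 0 < b := by
    have : Nontrivial (E ⧸ W) := Submodule.Quotient.nontrivial_iff.2 hW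
    exact finrank_pos
  have ha0 : 0 < a := by
    refine Nat.pos_of_ne_zero fun h => hW ?_
    rw [ha, Finset.card_eq_zero, Finset.filter_eq_empty_iff] at h
    rw [← top_le_iff, ← hspan, Submodule.span_le]
    rintro _ ⟨i, rfl⟩
    exact not_not.1 (h (Finset.mem_univ i))
  let e : (E ⧸ W) ≃ₗ[ℂ] (Fin b → ℂ) := LinearEquiv.ofFinrankEq _ _ (by simp [hb])
  let φ : E →ₗ[ℂ] (Fin b → ℂ) := e.toLinearMap ∘ₗ W.mkQ
  have hφ0 : ∀ y, φ y = 0 ↔ y ∈ W := fun y => by simp [φ]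
  have hφ : Function.Surjective φ := e.surjective.comp W.mkQ_surjective
  let s : Fin a ≃ {i // x i ∉ W} := (Fintype.equivFinOfCardEq (by
    rw [Fintype.card_subtype])).symm
  let w : Fin a → Fin b → ℂ := fun k => φ (x (s k))
  have hw : ∀ k, w k ≠ 0 := fun k h => (s k).2 ((hφ0 _).1 h)
  have hws : ∀ i (h : x i ∉ W), w (s.symm ⟨i, h⟩) = φ (x i) := fun i h => by simp [w]
  have hwspan : Submodule.span ℂ (Set.range w) = ⊤ := by
    rw [← top_le_iff, ← LinearMap.range_eq_top.2 hφ, ← Submodule.map_top, ← hspan,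
      Submodule.map_span, Submodule.span_le]
    rintro _ ⟨_, ⟨i, rfl⟩, rfl⟩
    by_cases h : x i ∈ W
    · rw [(hφ0 _).2 h]; exact Submodule.zero_mem _
    · rw [← hws i h]; exact Submodule.subset_span ⟨_, rfl⟩
  have hden : ∀ U : Submodule ℂ (Fin b → ℂ), U ≠ ⊥ → U ≠ ⊤ →
      b * (Finset.univ.filter fun i => w i ∈ U).card < a * finrank ℂ U := by
    intro U hU hU'
    have hker : LinearMap.ker φ = W := by ext y; exact hφ0 y
    have hlt : W < U.comap φ := by
      rw [← hker, ← Submodule.comap_bot]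
      exact (Submodule.comap_strictMono_of_surjective hφ) (bot_lt_iff_ne_bot.2 hU)
    have hne : U.comap φ ≠ ⊤ := fun h => hU' <| by
      rw [← Submodule.map_comap_eq_of_surjective hφ U, h, Submodule.map_top,
        LinearMap.range_eq_top.2 hφ]
    have h1 := hWlt _ hlt hne
    have h2 : finrank ℂ (E ⧸ U.comap φ) + finrank ℂ U = b := by
      have h3 : LinearMap.ker (U.mkQ ∘ₗ φ) = U.comap φ := by
        rw [LinearMap.ker_comp, Submodule.ker_mkQ]
      rw [← h3, ((U.mkQ ∘ₗ φ).quotKerEquivOfSurjective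
        (U.mkQ_surjective.comp hφ)).finrank_eq, U.finrank_quotient_add_finrank, finrank_fin_fun]
    have h3 : (Finset.univ.filter fun i => w i ∈ U).card +
        (Finset.univ.filter fun i => x i ∉ U.comap φ).card = a := by
      have h4 := Finset.card_filter_add_card_filter_not (s := Finset.univ) fun i => w i ∈ U
      rw [Finset.card_univ, Fintype.card_fin] at h4
      refine (congrArg _ (Eq.symm ?_)).trans h4
      refine Finset.card_bij (fun k _ => (s k : Fin m)) (fun k hk => ?_) (fun k _ l _ h => ?_)
        fun i hi => ?_
      · simpa [w] using hk
      · exact s.injective (Subtype.ext h)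
      · simp only [Finset.mem_filter, Finset.mem_univ, true_and] at hi
        have hiW : x i ∉ W := fun h => hi (hlt.le h)
        refine ⟨s.symm ⟨i, hiW⟩, ?_, by simp⟩
        simp only [Finset.mem_filter, Finset.mem_univ, true_and, hws]
        exact hi
    nlinarith
  have hmain := sq_mul_le_of_robust_span hb0 w hw hwspan hden
    (D := δ * m) (by positivity) fun Δ hΔ i => by
      obtain ⟨j, hj, k, hk, hmem⟩ := hrob (Δ.map (s.toEmbedding.trans (.subtype _)))
        (by simpa using hΔ) (s i)
      have hval : ∀ j ∉ Δ.map (s.toEmbedding.trans (.subtype _)),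
          φ (x j) = 0 ∨ ∃ l ∉ Δ, φ (x j) = w l := fun j hj => by
        by_cases h : x j ∈ W
        · exact Or.inl ((hφ0 _).2 h)
        · refine Or.inr ⟨s.symm ⟨j, h⟩, fun hl => hj ?_, (hws j h).symm⟩
          exact Finset.mem_map.2 ⟨_, hl, by simp⟩
      refine ⟨φ (x j), φ (x k), hval j hj, hval k hk, ?_⟩
      have := Submodule.mem_map_of_mem (f := φ) hmem
      rwa [Submodule.map_span, Set.image_pair] at this
  rw [Fintype.card_fin] at hWle
  have hWle' : (a : ℝ) * finrank ℂ E ≤ m * b := by exact_mod_cast hWle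
  have ham : (a : ℝ) ≤ m := by
    have := Finset.card_le_univ (Finset.univ.filter fun i => x i ∉ W)
    rw [Fintype.card_fin] at this
    exact_mod_cast this
  have ha0' : (0 : ℝ) < a := by exact_mod_cast ha0
  have hm' : (0 : ℝ) < m := by exact_mod_cast hm
  have h1 : (a * m) * (δ ^ 2 * finrank ℂ E) ≤ (a * m) * 16 := by
    calc (a * m) * (δ ^ 2 * finrank ℂ E) = δ ^ 2 * m * (a * finrank ℂ E) := by ring
      _ ≤ δ ^ 2 * m * (m * b) := by gcongr
      _ = (δ * m) ^ 2 * b := by ring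
      _ ≤ 16 * (a : ℝ) ^ 2 := hmain
      _ = 16 * (a * a) := by ring
      _ ≤ 16 * (a * m) := by gcongr
      _ = _ := by ring
  exact le_of_mul_le_mul_left h1 (by positivity)

end DenseQuotient

theorem finrank_vectorSpan_range_le_finrank_span {ι V : Type*} [AddCommGroup V] [Module ℂ V]
    [FiniteDimensional ℂ V] (v : ι → V) :
    finrank ℂ (vectorSpan ℂ (Set.range v)) ≤
      finrank ℂ (Submodule.span ℂ (Set.range fun i => (v i, (1 : ℂ)))) := by
  rw [(Submodule.equivMapOfInjective (LinearMap.inl ℂ V ℂ) LinearMap.inl_injective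
    (vectorSpan ℂ (Set.range v))).finrank_eq]
  refine Submodule.finrank_mono ?_
  rw [vectorSpan_def, Submodule.map_span, Submodule.span_le]
  rintro _ ⟨_, ⟨_, ⟨i, rfl⟩, _, ⟨j, rfl⟩, rfl⟩, rfl⟩
  have h : LinearMap.inl ℂ V ℂ (v i -ᵥ v j) = (v i, (1 : ℂ)) - (v j, (1 : ℂ)) := by simp
  change LinearMap.inl ℂ V ℂ (v i -ᵥ v j) ∈ _
  rw [h]
  exact Submodule.sub_mem _ (Submodule.subset_span ⟨i, rfl⟩) (Submodule.subset_span ⟨j, rfl⟩)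

end Helpers


/-- A list `v₁, …, v_m` of nonzero points of `ℂ^d` (possibly with repetitions) forming
a `δ`-LCC configuration — for every `Δ ⊆ [m]` of size at most `δ m` and every `i`,
there exist `j, k ∉ Δ` with `v i ∈ {v j, v k}` or `v i, v j, v k` three distinct
collinear points — has affine dimension at most `O(1/δ⁹)`. -/
theorem lcc_configuration_dim_bound :
    ∃ K : ℝ, 0 < K ∧ ∀ (m d : ℕ) (δ : ℝ), 0 < δ →
      ∀ v : Fin m → (Fin d → ℂ), (∀ i, v i ≠ 0) →
      (∀ Δ : Finset (Fin m), (Δ.card : ℝ) ≤ δ * m → ∀ i : Fin m,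
        ∃ j k : Fin m, j ∉ Δ ∧ k ∉ Δ ∧
          (v i = v j ∨ v i = v k ∨
            (v i ≠ v j ∧ v i ≠ v k ∧ v j ≠ v k ∧
              Collinear ℂ ({v i, v j, v k} : Set (Fin d → ℂ))))) →
      (Module.finrank ℂ (vectorSpan ℂ (Set.range v)) : ℝ) ≤ K / δ ^ 9 := by
  refine ⟨16, by norm_num, fun m d δ hδ v hv hlcc => ?_⟩
  rcases Nat.eq_zero_or_pos m with rfl | hm
  · rw [Set.range_eq_empty, vectorSpan_empty, finrank_bot, Nat.cast_zero]
    positivity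
  have hm' : (0 : ℝ) < m := by exact_mod_cast hm
  have hδ1 : δ < 1 := by
    by_contra! h
    obtain ⟨j, -, hj, -⟩ := hlcc Finset.univ (by simpa using le_mul_of_one_le_left hm'.le h) ⟨0, hm⟩
    exact hj (Finset.mem_univ j)
  let y : Fin m → (Fin d → ℂ) × ℂ := fun i => (v i, 1)
  let x : Fin m → Submodule.span ℂ (Set.range y) := fun i => ⟨y i, Submodule.subset_span ⟨i, rfl⟩⟩
  have hspan : Submodule.span ℂ (Set.range x) = ⊤ := by
    apply Submodule.map_injective_of_injective (Submodule.subtype_injective _)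
    rw [Submodule.map_span, ← Set.range_comp, Submodule.map_subtype_top]
    rfl
  have hbound := sq_mul_finrank_le_of_robust_span hm x hspan hδ fun Δ hΔ i => by
    obtain ⟨j, k, hj, hk, h⟩ := hlcc Δ hΔ i
    refine ⟨j, hj, k, hk, ?_⟩
    rcases h with h | h | ⟨-, -, hjk, hcol⟩
    · have hx : x i = x j := Subtype.ext (Prod.ext h rfl)
      exact Submodule.subset_span (by simp [hx])
    · have hx : x i = x k := Subtype.ext (Prod.ext h rfl)
      exact Submodule.subset_span (by simp [hx])
    · have hline : v i ∈ line[ℂ, v j, v k] :=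
        hcol.mem_affineSpan_of_mem_of_ne (by simp) (by simp) (by simp) hjk
      obtain ⟨r, hr⟩ := mem_affineSpan_pair_iff_exists_lineMap_eq.1 hline
      refine Submodule.mem_span_pair.2 ⟨1 - r, r, Subtype.ext (Prod.ext ?_ ?_)⟩
      · rw [AffineMap.lineMap_apply_module] at hr
        exact hr
      · simp [x, y]
  have hle : (Module.finrank ℂ (vectorSpan ℂ (Set.range v)) : ℝ) ≤
      Module.finrank ℂ (Submodule.span ℂ (Set.range y)) := by
    exact_mod_cast finrank_vectorSpan_range_le_finrank_span v
  rw [le_div_iff₀ (by positivity)]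
  have hpow : δ ^ 9 ≤ δ ^ 2 := pow_le_pow_of_le_one hδ.le hδ1.le (by norm_num)
  calc _ ≤ (Module.finrank ℂ (Submodule.span ℂ (Set.range y)) : ℝ) * δ ^ 2 := by gcongr
    _ ≤ 16 := by rwa [mul_comm]
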